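/- Let u ∈ L be an element whose centralizer M = C(u) = {y ∈ L : ⁅y,u⁆ = 0} (a Lie subalgebra of L) has codimension one in L. Then: (i) i(M) = i(L) + 1; (ii) L has a CP if and only if M has a CP; (iii) if L is square integrable then so is M. -/

import Mathlib

open Module

noncomputable section

variable (k : Type*) [Field k]

/-- `L(f) = {x ∈ L | f ⁅x, y⁆ = 0 for all y ∈ L}`. -/
def lieStab (L : Type*) [LieRing L] [LieAlgebra k L] (f : Module.Dual k L) :
    Submodule k L where
  carrier := {x | ∀ y : L, f ⁅x, y⁆ = 0}
  add_mem' := fun {a b} ha hb y => by rw [add_lie, map_add, ha y, hb y, add_zero]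
  zero_mem' := fun y => by rw [zero_lie, map_zero]
  smul_mem' := fun c a ha y => by rw [smul_lie, map_smul, ha y, smul_zero]

/-- The index `i(L)`, the minimum of `dim L(f)` over all `f ∈ L*`. -/
def lieIndex (L : Type*) [LieRing L] [LieAlgebra k L] : ℕ :=
  ⨅ f : Module.Dual k L, finrank k (lieStab k L f)

/-- `f ∈ L*` is regular if `dim L(f) = i(L)`. -/
def LieIsRegular (L : Type*) [LieRing L] [LieAlgebra k L] (f : Module.Dual k L) : Prop :=
  finrank k (lieStab k L f) = lieIndex k L

/-- A commutative polarization of `L`: an abelian Lie subalgebra `P` with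
`2 dim P = dim L + i(L)`. -/
def IsCP (L : Type*) [LieRing L] [LieAlgebra k L] (P : LieSubalgebra k L) : Prop :=
  IsLieAbelian ↥P ∧ 2 * finrank k ↥P = finrank k L + lieIndex k L

/-- A CP-ideal of `L`: a CP which is also a Lie ideal of `L`. -/
def IsCPIdeal (L : Type*) [LieRing L] [LieAlgebra k L] (P : LieSubalgebra k L) : Prop :=
  IsCP k L P ∧ ∀ x y : L, y ∈ P → ⁅x, y⁆ ∈ P

/-- `L` is square integrable if `i(L) = dim Z(L)`. -/
def SquareIntegrable (L : Type*) [LieRing L] [LieAlgebra k L] : Prop :=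
  lieIndex k L = finrank k ↥(LieAlgebra.center k L)


/-- On a line `s ↦ s • A + B` of linear maps, some member has kernel no larger than that of `A`. -/
theorem exists_finrank_ker_smul_add_le {k V W : Type*} [Field k] [Infinite k]
    [AddCommGroup V] [Module k V] [FiniteDimensional k V] [AddCommGroup W] [Module k W]
    (A B : V →ₗ[k] W) :
    ∃ s : k, finrank k (LinearMap.ker (s • A + B)) ≤ finrank k (LinearMap.ker A) := by
  obtain ⟨U, hU⟩ := Submodule.exists_isCompl (LinearMap.ker A)
  have hker : LinearMap.ker (A.domRestrict U) = ⊥ := by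
    rw [LinearMap.ker_eq_bot']
    intro x hx
    have h : (x : V) ∈ LinearMap.ker A ⊓ U := ⟨hx, x.2⟩
    rw [hU.inf_eq_bot] at h
    exact Subtype.ext h
  obtain ⟨C, hC⟩ := LinearMap.exists_leftInverse_of_injective _ hker
  obtain ⟨t, ht⟩ := (Module.End.finite_hasEigenvalue (C ∘ₗ B.domRestrict U)).exists_notMem
  refine ⟨-t, ?_⟩
  have hdisj : LinearMap.ker (-t • A + B) ⊓ U = ⊥ := by
    rw [eq_bot_iff]
    rintro x ⟨hx, hxU⟩
    by_contra hx0
    apply ht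
    refine Module.End.hasEigenvalue_of_hasEigenvector (x := ⟨x, hxU⟩)
      ⟨Module.End.mem_eigenspace_iff.2 ?_, fun h => hx0 (congrArg Subtype.val h)⟩
    have hBA : B x = t • A x := by
      have h : -t • A x + B x = 0 := hx
      rw [neg_smul] at h
      exact (neg_add_eq_zero.1 h).symm
    have hCA : C (A x) = ⟨x, hxU⟩ := LinearMap.congr_fun hC ⟨x, hxU⟩
    change C (B x) = _
    rw [hBA, map_smul, hCA]
  have h₁ := Submodule.finrank_sup_add_finrank_inf_eq (LinearMap.ker (-t • A + B)) U
  rw [hdisj, finrank_bot] at h₁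
  have h₂ := Submodule.finrank_add_eq_of_isCompl hU
  have h₃ := Submodule.finrank_le (LinearMap.ker (-t • A + B) ⊔ U)
  omega

theorem lieIndex_le {k L : Type*} [Field k] [LieRing L] [LieAlgebra k L] (f : Module.Dual k L) :
    lieIndex k L ≤ finrank k (lieStab k L f) :=
  ciInf_le (OrderBot.bddBelow _) f

theorem exists_lieIsRegular (k L : Type*) [Field k] [LieRing L] [LieAlgebra k L] :
    ∃ f : Module.Dual k L, LieIsRegular k L f :=
  Nat.sInf_mem (Set.range_nonempty fun f : Module.Dual k L => finrank k (lieStab k L f))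

/-- The alternating form `(x, y) ↦ f ⁅x, y⁆` has radical `L(f)`. -/
theorem ker_compr₂_toEnd {k L : Type*} [Field k] [LieRing L] [LieAlgebra k L]
    (f : Module.Dual k L) :
    LinearMap.ker ((LieModule.toEnd k L L : L →ₗ[k] L →ₗ[k] L).compr₂ f) = lieStab k L f := by
  ext x
  exact LinearMap.ext_iff

theorem exists_lieIsRegular_apply_ne_zero {k L : Type*} [Field k] [Infinite k] [LieRing L]
    [LieAlgebra k L] [FiniteDimensional k L] {w : L} (hw : w ≠ 0) :
    ∃ f : Module.Dual k L, LieIsRegular k L f ∧ f w ≠ 0 := by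
  obtain ⟨f, hf⟩ := exists_lieIsRegular k L
  by_cases hfw : f w = 0
  · obtain ⟨g, hg⟩ := Module.Projective.exists_dual_ne_zero k hw
    obtain ⟨s, hs⟩ := exists_finrank_ker_smul_add_le
      ((LieModule.toEnd k L L : L →ₗ[k] L →ₗ[k] L).compr₂ f)
      ((LieModule.toEnd k L L : L →ₗ[k] L →ₗ[k] L).compr₂ g)
    have hlin : s • (LieModule.toEnd k L L : L →ₗ[k] L →ₗ[k] L).compr₂ f
        + (LieModule.toEnd k L L : L →ₗ[k] L →ₗ[k] L).compr₂ g
        = (LieModule.toEnd k L L : L →ₗ[k] L →ₗ[k] L).compr₂ (s • f + g) := rfl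
    rw [hlin, ker_compr₂_toEnd, ker_compr₂_toEnd] at hs
    exact ⟨s • f + g, le_antisymm (hs.trans_eq hf) (lieIndex_le _), by simpa [hfw] using hg⟩
  · exact ⟨f, hf, hfw⟩

theorem finrank_center_le_lieIndex (k L : Type*) [Field k] [LieRing L] [LieAlgebra k L]
    [FiniteDimensional k L] : finrank k (LieAlgebra.center k L) ≤ lieIndex k L := by
  obtain ⟨f, hf⟩ := exists_lieIsRegular k L
  rw [← hf]
  refine Submodule.finrank_mono (s := (LieAlgebra.center k L).toSubmodule) fun x hx y => ?_
  have h : ⁅y, x⁆ = 0 := (LieModule.mem_maxTrivSubmodule k L L x).1 hx y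
  rw [← lie_skew, h, neg_zero, map_zero]

theorem finrank_sup_span_singleton {k V : Type*} [Field k] [AddCommGroup V] [Module k V]
    [FiniteDimensional k V] {S : Submodule k V} {u : V} (hu : u ∉ S) :
    finrank k ↥(S ⊔ k ∙ u) = finrank k S + 1 := by
  have hu0 : u ≠ 0 := fun h => hu (h ▸ S.zero_mem)
  have h := Submodule.finrank_sup_add_finrank_inf_eq S (k ∙ u)
  rwa [((Submodule.disjoint_span_singleton' hu0).2 hu).eq_bot, finrank_bot,
    finrank_span_singleton hu0, add_zero] at h

/-- A hyperplane, together with any outside element, spans. -/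
theorem exists_sub_smul_mem_of_codim_one {k V : Type*} [Field k] [AddCommGroup V] [Module k V]
    [FiniteDimensional k V] {S : Submodule k V} (hS : finrank k S + 1 = finrank k V) {a : V}
    (ha : a ∉ S) (y : V) : ∃ c : k, y - c • a ∈ S := by
  have htop : S ⊔ k ∙ a = ⊤ :=
    Submodule.eq_top_of_finrank_eq ((finrank_sup_span_singleton ha).trans hS)
  have hy : y ∈ S ⊔ k ∙ a := htop ▸ Submodule.mem_top
  obtain ⟨m, hm, z, hz, rfl⟩ := Submodule.mem_sup.1 hy
  obtain ⟨c, rfl⟩ := Submodule.mem_span_singleton.1 hz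
  exact ⟨c, by simpa using hm⟩

section Centralizer

variable {k L : Type*} [Field k] [LieRing L] [LieAlgebra k L] [FiniteDimensional k L]
  {u : L} {M : LieSubalgebra k L}

/-- If `f` does not vanish on `⁅L, u⁆`, restricting `f` to `M = C(u)` enlarges the stabilizer by
exactly the line through `u`. -/
theorem finrank_lieStab_restrict (hMu : ∀ y : L, y ∈ M ↔ ⁅y, u⁆ = 0)
    (hM : finrank k M + 1 = finrank k L) {a : L} (ha : a ∉ M) (f : Module.Dual k L)
    (hf : f ⁅a, u⁆ ≠ 0) :
    finrank k (lieStab k M (f ∘ₗ M.toSubmodule.subtype)) = finrank k (lieStab k L f) + 1 := by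
  have hsplit := exists_sub_smul_mem_of_codim_one (S := M.toSubmodule) hM ha
  have hcomm : ∀ y ∈ M, ⁅u, y⁆ = 0 := fun y hy => by
    rw [← lie_skew, (hMu y).1 hy, neg_zero]
  have hu : u ∉ lieStab k L f := fun h => hf (by rw [← lie_skew, map_neg, h a, neg_zero])
  have hle : lieStab k L f ≤ M.toSubmodule := by
    intro x hx
    obtain ⟨c, hc⟩ := hsplit x
    have hxu : ⁅x, u⁆ = c • ⁅a, u⁆ := by
      have h := (hMu _).1 hc
      rwa [sub_lie, smul_lie, sub_eq_zero] at h
    have h := hx u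
    rw [hxu, map_smul, smul_eq_mul] at h
    have hc0 := (mul_eq_zero.1 h).resolve_right hf
    simpa [hc0] using hc
  rw [← finrank_sup_span_singleton hu]
  refine (Submodule.finrank_map_subtype_eq M.toSubmodule
    (lieStab k M (f ∘ₗ M.toSubmodule.subtype))).symm.trans ?_
  refine congrArg (fun S : Submodule k L => finrank k S) (le_antisymm ?_ (sup_le ?_ ?_))
  · rintro _ ⟨y, hy, rfl⟩
    set c : k := f ⁅(y : L), a⁆ / f ⁅a, u⁆ with hc
    refine Submodule.mem_sup.2 ⟨(y : L) + c • u, fun z => ?_, -c • u,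
      Submodule.mem_span_singleton.2 ⟨-c, rfl⟩, by simp⟩
    obtain ⟨d, hd⟩ := hsplit z
    have hz : z = (z - d • a) + d • a := by abel
    have h₁ : f ⁅(y : L), z - d • a⁆ = 0 := hy ⟨_, hd⟩
    have h₂ : f ⁅u, a⁆ = - f ⁅a, u⁆ := by rw [← lie_skew, map_neg]
    rw [hz, lie_add, add_lie, smul_lie, hcomm _ hd, lie_smul, add_lie, smul_lie]
    simp only [map_add, map_smul, smul_zero, add_zero, h₁, h₂, smul_eq_mul, zero_add]
    rw [hc]
    field_simp
    ring
  · exact fun x hx => ⟨⟨x, hle hx⟩, fun y => hx y, rfl⟩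
  · rw [Submodule.span_singleton_le_iff_mem]
    refine ⟨⟨u, (hMu u).2 (lie_self u)⟩, fun y => ?_, rfl⟩
    change f ⁅u, (y : L)⁆ = 0
    rw [hcomm _ y.2, map_zero]

theorem lieIndex_centralizer [Infinite k] (hMu : ∀ y : L, y ∈ M ↔ ⁅y, u⁆ = 0)
    (hM : finrank k M + 1 = finrank k L) {a : L} (ha : a ∉ M) :
    lieIndex k M = lieIndex k L + 1 := by
  have hw : ⁅a, u⁆ ≠ 0 := fun h => ha ((hMu a).2 h)
  apply le_antisymm
  · obtain ⟨f, hf, hfw⟩ := exists_lieIsRegular_apply_ne_zero (k := k) hw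
    rw [← hf, ← finrank_lieStab_restrict hMu hM ha f hfw]
    exact lieIndex_le _
  · obtain ⟨f, hf, hfw⟩ : ∃ f : Module.Dual k L,
        LieIsRegular k M (f ∘ₗ M.toSubmodule.subtype) ∧ f ⁅a, u⁆ ≠ 0 := by
      by_cases hwM : ⁅a, u⁆ ∈ M
      · obtain ⟨g, hg, hgw⟩ := exists_lieIsRegular_apply_ne_zero (k := k) (L := M)
          (w := ⟨⁅a, u⁆, hwM⟩) (fun h => hw (congrArg Subtype.val h))
        obtain ⟨f, rfl⟩ := LinearMap.exists_extend (p := M.toSubmodule) g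
        exact ⟨f, hg, hgw⟩
      · obtain ⟨g, hg⟩ := exists_lieIsRegular k M
        obtain ⟨f, rfl⟩ := LinearMap.exists_extend (p := M.toSubmodule) g
        by_cases hfw : f ⁅a, u⁆ = 0
        · obtain ⟨φ, hφ, hφM⟩ :=
            Submodule.exists_dual_map_eq_bot_of_notMem (p := M.toSubmodule) hwM inferInstance
          refine ⟨f + φ, ?_, by simpa [hfw] using hφ⟩
          have hext : (f + φ) ∘ₗ M.toSubmodule.subtype = f ∘ₗ M.toSubmodule.subtype := by
            ext y
            have hy : φ (y : L) ∈ M.toSubmodule.map φ := Submodule.mem_map_of_mem y.2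
            rw [hφM, Submodule.mem_bot] at hy
            simp [hy]
          rw [hext]
          exact hg
        · exact ⟨f, hg, hfw⟩
    rw [← hf, finrank_lieStab_restrict hMu hM ha f hfw]
    exact Nat.succ_le_succ (lieIndex_le f)

/-- An abelian subalgebra of `L` not contained in `M = C(u)` can be exchanged for one of the same
dimension inside `M`. -/
theorem exists_abelian_le_centralizer (hMu : ∀ y : L, y ∈ M ↔ ⁅y, u⁆ = 0)
    (hM : finrank k M + 1 = finrank k L) (P : LieSubalgebra k L)
    (hP : ∀ x ∈ P, ∀ y ∈ P, ⁅x, y⁆ = 0) :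
    ∃ S : Submodule k L, S ≤ M.toSubmodule ∧ (∀ x ∈ S, ∀ y ∈ S, ⁅x, y⁆ = 0) ∧
      finrank k S = finrank k P := by
  by_cases hPM : P ≤ M
  · exact ⟨P.toSubmodule, hPM, hP, rfl⟩
  obtain ⟨b, hbP, hbM⟩ := SetLike.not_le_iff_exists.1 hPM
  have huP : u ∉ P := fun h => hbM ((hMu b).2 (hP b hbP u h))
  have hbS : b ∉ P.toSubmodule ⊓ M.toSubmodule := fun h => hbM h.2
  have huS : u ∉ P.toSubmodule ⊓ M.toSubmodule := fun h => huP h.1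
  have hsup : (P.toSubmodule ⊓ M.toSubmodule) ⊔ k ∙ b = P.toSubmodule := by
    apply le_antisymm
    · exact sup_le inf_le_left ((Submodule.span_singleton_le_iff_mem _ _).2 hbP)
    · intro x hx
      obtain ⟨c, hc⟩ := exists_sub_smul_mem_of_codim_one (S := M.toSubmodule) hM hbM x
      exact Submodule.mem_sup.2 ⟨x - c • b, ⟨P.sub_mem hx (P.smul_mem c hbP), hc⟩, c • b,
        Submodule.mem_span_singleton.2 ⟨c, rfl⟩, by abel⟩
  refine ⟨(P.toSubmodule ⊓ M.toSubmodule) ⊔ k ∙ u, ?_, ?_, ?_⟩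
  · exact sup_le inf_le_right
      ((Submodule.span_singleton_le_iff_mem _ _).2 ((hMu u).2 (lie_self u)))
  · intro x hx y hy
    obtain ⟨p, hp, _, hp', rfl⟩ := Submodule.mem_sup.1 hx
    obtain ⟨q, hq, _, hq', rfl⟩ := Submodule.mem_sup.1 hy
    obtain ⟨c, rfl⟩ := Submodule.mem_span_singleton.1 hp'
    obtain ⟨d, rfl⟩ := Submodule.mem_span_singleton.1 hq'
    have hpu : ⁅p, u⁆ = 0 := (hMu p).1 hp.2
    have huq : ⁅u, q⁆ = 0 := by rw [← lie_skew, (hMu q).1 hq.2, neg_zero]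
    simp [hP p hp.1 q hq.1, hpu, huq]
  · rw [finrank_sup_span_singleton huS, ← finrank_sup_span_singleton hbS, hsup]
    rfl

end Centralizer

/-- **Proposition 1.9.** Suppose `u ∈ L` has centralizer `M = C(u)` of codimension one in `L`.
Then (i) `i(M) = i(L) + 1`; (ii) `L` has a CP iff `M` has a CP; (iii) if `L` is square
integrable then so is `M`. -/
theorem centralizer_codim_one {k L : Type*} [Field k] [CharZero k] [LieRing L]
    [LieAlgebra k L] [FiniteDimensional k L] (u : L) (M : LieSubalgebra k L)
    (hMu : ∀ y : L, y ∈ M ↔ ⁅y, u⁆ = 0)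
    (hM : finrank k ↥M + 1 = finrank k L) :
    lieIndex k ↥M = lieIndex k L + 1 ∧
    ((∃ P : LieSubalgebra k L, IsCP k L P) ↔ (∃ Q : LieSubalgebra k ↥M, IsCP k ↥M Q)) ∧
    (SquareIntegrable k L → SquareIntegrable k ↥M) := by
  have : Infinite k := Infinite.of_injective _ (Nat.cast_injective (R := k))
  obtain ⟨a, ha⟩ : ∃ a, a ∉ M := by
    by_contra! h
    have htop : M.toSubmodule = ⊤ := (Submodule.eq_top_iff').2 h
    have hfin : finrank k M = finrank k L := by
      change finrank k M.toSubmodule = _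
      rw [htop, finrank_top]
    omega
  have hu : u ∈ M := (hMu u).2 (lie_self u)
  have hidx := lieIndex_centralizer hMu hM ha
  refine ⟨hidx, ⟨?_, ?_⟩, fun hsq => ?_⟩
  · rintro ⟨P, hPab, hPdim⟩
    obtain ⟨S, hSM, hSab, hSdim⟩ := exists_abelian_le_centralizer hMu hM P
      fun x hx y hy => congrArg Subtype.val (hPab.trivial ⟨x, hx⟩ ⟨y, hy⟩)
    have hab : ∀ x y : M, (x : L) ∈ S → (y : L) ∈ S → ⁅x, y⁆ = 0 := fun x y hx hy =>
      Subtype.ext (hSab x hx y hy)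
    let Q : LieSubalgebra k M :=
      { S.comap M.toSubmodule.subtype with
        lie_mem' := fun {x y} hx hy => by
          rw [hab x y hx hy]
          exact S.zero_mem }
    refine ⟨Q, ⟨fun x y => Subtype.ext (hab x y x.2 y.2)⟩, ?_⟩
    have hQ : finrank k Q = finrank k S :=
      (Submodule.comapSubtypeEquivOfLe hSM).finrank_eq
    omega
  · rintro ⟨Q, hQab, hQdim⟩
    refine ⟨Q.map M.incl, ⟨?_⟩, ?_⟩
    · rintro ⟨_, x, hx, rfl⟩ ⟨_, y, hy, rfl⟩
      have h := congrArg Subtype.val (hQab.trivial ⟨x, hx⟩ ⟨y, hy⟩)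
      exact Subtype.ext (congrArg (Subtype.val : M → L) h)
    · have hdim : finrank k (Q.map M.incl) = finrank k Q :=
        Submodule.finrank_map_subtype_eq M.toSubmodule Q.toSubmodule
      omega
  · apply le_antisymm _ (finrank_center_le_lieIndex k M)
    rw [hidx, hsq]
    have hmem : ∀ {x : L}, x ∈ (LieAlgebra.center k L).toSubmodule ↔ ∀ y : L, ⁅y, x⁆ = 0 :=
      fun {x} => LieModule.mem_maxTrivSubmodule k L L x
    have huZ : u ∉ (LieAlgebra.center k L).toSubmodule := fun h =>
      ha ((hMu a).2 (hmem.1 h a))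
    have hle : (LieAlgebra.center k L).toSubmodule ⊔ k ∙ u ≤
        (LieAlgebra.center k M).toSubmodule.map M.toSubmodule.subtype := by
      refine sup_le (fun x hx => ?_) ((Submodule.span_singleton_le_iff_mem _ _).2 ?_)
      · have hxM : x ∈ M := (hMu x).2 (by rw [← lie_skew, hmem.1 hx u, neg_zero])
        exact ⟨⟨x, hxM⟩, (LieModule.mem_maxTrivSubmodule k M M _).2
          fun y => Subtype.ext (hmem.1 hx y), rfl⟩
      · exact ⟨⟨u, hu⟩, (LieModule.mem_maxTrivSubmodule k M M _).2
          fun y => Subtype.ext ((hMu y).1 y.2), rfl⟩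
    have h := Submodule.finrank_mono hle
    rw [finrank_sup_span_singleton huZ, Submodule.finrank_map_subtype_eq] at h
    exact h

end
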